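/- Let 0 < δ < 1/2, 0 < γ < 1 and ε > H(δ) be constants. Then there exist a constant p ∈ (0,1/2), a constant D > 0 and an integer n₀ such that for every n ≥ n₀, with m = ⌈εn⌉: for every set E of m×n binary matrices with μ(E) ≥ e^{-Dn}, there exists a matrix H ∈ E whose kernel code C = {c ∈ 𝔽₂ⁿ : Hc = 0} satisfies (i) the minimum Hamming distance of C is at least δn + 1 (relative distance at least δ); (ii) diversity index at least γ, i.e. #(R_x ∖ R_y) ≥ γ·#R_x for every pair of rows x, y, where R_j = {i : H_{j,i} = 1}; and (iii) #C ≥ 2^{n−m} (so the redundancy of C is at most ε). -/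

import Mathlib

/-- Weight of a binary matrix under i.i.d. Bernoulli(p) entries: entry `1` has
probability `p`, entry `0` has probability `1 - p`. -/
noncomputable def matWeight (m n : ℕ) (p : ℝ) (X : Matrix (Fin m) (Fin n) (ZMod 2)) : ℝ :=
  ∏ j : Fin m, ∏ i : Fin n, if X j i = 1 then p else 1 - p

/-- The probability measure `μ` on `m × n` binary matrices with i.i.d. Bernoulli(p)
entries, evaluated on an event `E`. -/
noncomputable def matProb (m n : ℕ) (p : ℝ) (E : Set (Matrix (Fin m) (Fin n) (ZMod 2))) : ℝ :=
  ∑ X : Matrix (Fin m) (Fin n) (ZMod 2), E.indicator (matWeight m n p) X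

/-- `R_j`, the set of left neighbours of the right vertex `b_j`. -/
def rightNbrs {m n : ℕ} (X : Matrix (Fin m) (Fin n) (ZMod 2)) (j : Fin m) : Finset (Fin n) :=
  Finset.univ.filter fun i => X j i = 1

/-- The binary entropy function `H(x) = -x log₂ x - (1-x) log₂ (1-x)`. -/
noncomputable def binH (x : ℝ) : ℝ := -x * Real.logb 2 x - (1 - x) * Real.logb 2 (1 - x)

/-- Bernoulli(p) weight of a single bit. -/
noncomputable def bitWeight (p : ℝ) (b : ZMod 2) : ℝ := if b = 1 then p else 1 - p

/-- The nontrivial additive character of `ZMod 2`. -/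
noncomputable def signChar (a : ZMod 2) : ℝ := if a = 0 then 1 else -1

lemma sum_zmod_two (f : ZMod 2 → ℝ) : ∑ b, f b = f 0 + f 1 :=
  Fin.sum_univ_two f

lemma bitWeight_zero (p : ℝ) : bitWeight p 0 = 1 - p := by simp [bitWeight]

lemma bitWeight_one (p : ℝ) : bitWeight p 1 = p := by simp [bitWeight]

lemma zmod_two_cases (a : ZMod 2) : a = 0 ∨ a = 1 := by
  revert a; decide

lemma signChar_add (a b : ZMod 2) : signChar (a + b) = signChar a * signChar b := by
  have h : (1 + 1 : ZMod 2) = 0 := by decide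
  rcases zmod_two_cases a with rfl | rfl <;> rcases zmod_two_cases b with rfl | rfl <;>
    simp [signChar, h]

lemma signChar_sum {ι : Type*} (s : Finset ι) (f : ι → ZMod 2) :
    signChar (∑ i ∈ s, f i) = ∏ i ∈ s, signChar (f i) := by
  classical
  induction s using Finset.induction_on with
  | empty => simp [signChar]
  | insert a s ha ih => rw [Finset.sum_insert ha, Finset.prod_insert ha, signChar_add, ih]

lemma ite_eq_zero_signChar (a : ZMod 2) :
    (if a = 0 then (1 : ℝ) else 0) = (1 + signChar a) / 2 := by
  unfold signChar; split_ifs <;> norm_num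

lemma matWeight_eq (m n : ℕ) (p : ℝ) (X : Matrix (Fin m) (Fin n) (ZMod 2)) :
    matWeight m n p X = ∏ j, ∏ i, bitWeight p (X j i) := rfl

lemma matWeight_nonneg {m n : ℕ} {p : ℝ} (hp0 : 0 ≤ p) (hp1 : p ≤ 1)
    (X : Matrix (Fin m) (Fin n) (ZMod 2)) : 0 ≤ matWeight m n p X := by
  refine Finset.prod_nonneg fun j _ => Finset.prod_nonneg fun i _ => ?_
  split_ifs <;> linarith

lemma prod_sum_pi {ι κ : Type*} [Fintype ι] [DecidableEq ι] [Fintype κ] (f : ι → κ → ℝ) :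
    ∏ i, ∑ b, f i b = ∑ r : ι → κ, ∏ i, f i (r i) := by
  rw [Finset.prod_univ_sum, Fintype.piFinset_univ]

/-- A fixed nonzero-weight linear form vanishes on a Bernoulli(p) vector with
probability `(1 + (1 - 2p)^w) / 2`. -/
lemma sum_row_orthogonal (n : ℕ) (p : ℝ) (c : Fin n → ZMod 2) :
    ∑ r : Fin n → ZMod 2, (∏ i, bitWeight p (r i)) * (if r ⬝ᵥ c = 0 then (1 : ℝ) else 0)
      = (1 + (1 - 2 * p) ^ hammingNorm c) / 2 := by
  have h1 : ∑ r : Fin n → ZMod 2, ∏ i, bitWeight p (r i) = 1 := by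
    rw [← prod_sum_pi (fun _ b => bitWeight p b)]
    simp [sum_zmod_two, bitWeight_zero, bitWeight_one]
  have h2 : ∑ r : Fin n → ZMod 2, (∏ i, bitWeight p (r i)) * signChar (r ⬝ᵥ c)
      = (1 - 2 * p) ^ hammingNorm c := by
    simp only [dotProduct, signChar_sum, ← Finset.prod_mul_distrib]
    rw [← prod_sum_pi (fun i b => bitWeight p b * signChar (b * c i)), hammingNorm,
      ← Finset.prod_const, Finset.prod_filter]
    refine Finset.prod_congr rfl fun i _ => ?_
    rw [sum_zmod_two, bitWeight_zero, bitWeight_one]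
    rcases zmod_two_cases (c i) with h | h <;> simp [h, signChar]
    ring
  calc _ = (∑ r : Fin n → ZMod 2, ∏ i, bitWeight p (r i)
        + ∑ r : Fin n → ZMod 2, (∏ i, bitWeight p (r i)) * signChar (r ⬝ᵥ c)) / 2 := by
        rw [← Finset.sum_add_distrib, Finset.sum_div]
        refine Finset.sum_congr rfl fun r _ => ?_
        rw [ite_eq_zero_signChar]; ring
    _ = _ := by rw [h1, h2]

lemma sum_matWeight_mulVec_eq_zero (m n : ℕ) (p : ℝ) (c : Fin n → ZMod 2) :
    ∑ X : Matrix (Fin m) (Fin n) (ZMod 2),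
        matWeight m n p X * (if X.mulVec c = 0 then (1 : ℝ) else 0)
      = ((1 + (1 - 2 * p) ^ hammingNorm c) / 2) ^ m := by
  rw [← sum_row_orthogonal, ← Fin.prod_const, prod_sum_pi]
  refine Finset.sum_congr rfl fun X _ => ?_
  rw [Finset.prod_mul_distrib, matWeight_eq]
  congr 1
  rw [Finset.prod_ite_zero]
  simp only [Finset.prod_const_one, Finset.mem_univ, true_imp_iff]
  exact if_congr funext_iff rfl rfl

/-- Two distinct coordinates of a Bernoulli(p) vector are independent. -/
lemma sum_bitWeight_two_coords {m : ℕ} (p : ℝ) {x y : Fin m} (hxy : x ≠ y)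
    (u v : ZMod 2 → ℝ) :
    ∑ col : Fin m → ZMod 2, (∏ j, bitWeight p (col j)) * (u (col x) * v (col y))
      = (∑ b, bitWeight p b * u b) * ∑ b, bitWeight p b * v b := by
  let F : Fin m → ZMod 2 → ℝ := fun j b =>
    bitWeight p b * ((if j = x then u b else 1) * (if j = y then v b else 1))
  have h : ∀ j, ∑ b, F j b = (if j = x then ∑ b, bitWeight p b * u b else 1)
      * (if j = y then ∑ b, bitWeight p b * v b else 1) := by
    intro j
    by_cases hx : j = x
    · have hy : j ≠ y := fun h => hxy (hx.symm.trans h)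
      simp [F, hx, hxy]
    · by_cases hy : j = y
      · simp [F, hy, hxy.symm]
      · simp [F, hx, hy, sum_zmod_two, bitWeight_zero, bitWeight_one]
  have h2 : ∏ j, ∑ b, F j b = (∑ b, bitWeight p b * u b) * ∑ b, bitWeight p b * v b := by
    simp only [h, Finset.prod_mul_distrib, Finset.prod_ite_eq', Finset.mem_univ, if_true]
  rw [← h2, prod_sum_pi]
  refine Finset.sum_congr rfl fun col _ => ?_
  simp only [F, Finset.prod_mul_distrib]
  congr 1
  simp

/-- The moment generating function of `γ #R_x - #(R_x \ R_y)` at `log 2`. -/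
lemma sum_matWeight_diversity {m n : ℕ} (p γ : ℝ) {x y : Fin m} (hxy : x ≠ y) :
    ∑ X : Matrix (Fin m) (Fin n) (ZMod 2), matWeight m n p X *
        (2 : ℝ) ^ (γ * ((rightNbrs X x).card : ℝ) - ((rightNbrs X x \ rightNbrs X y).card : ℝ))
      = (1 - p + p * ((1 + p) * (2 : ℝ) ^ (γ - 1))) ^ n := by
  let v : ZMod 2 → ℝ := fun b => if b = 1 then (2 : ℝ) ^ γ else (2 : ℝ) ^ (γ - 1)
  let g : ZMod 2 → ZMod 2 → ℝ := fun a b => if a = 1 then v b else 1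
  have hg : ∀ X : Matrix (Fin m) (Fin n) (ZMod 2),
      (2 : ℝ) ^ (γ * ((rightNbrs X x).card : ℝ) - ((rightNbrs X x \ rightNbrs X y).card : ℝ))
        = ∏ i, g (X x i) (X y i) := by
    intro X
    have hs : γ * ((rightNbrs X x).card : ℝ) - ((rightNbrs X x \ rightNbrs X y).card : ℝ)
        = ∑ i, ((if X x i = 1 then γ else 0) - (if X x i = 1 ∧ X y i ≠ 1 then 1 else 0)) := by
      have hd : rightNbrs X x \ rightNbrs X y
          = Finset.univ.filter fun i => X x i = 1 ∧ X y i ≠ 1 := by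
        ext i; simp [rightNbrs]
      rw [hd, Finset.sum_sub_distrib, ← Finset.sum_filter, Finset.sum_const, Finset.sum_boole,
        nsmul_eq_mul, mul_comm, rightNbrs]
    rw [hs, Real.rpow_sum_of_pos two_pos]
    refine Finset.prod_congr rfl fun i _ => ?_
    by_cases h1 : X x i = 1 <;> by_cases h2 : X y i = 1 <;> simp [g, v, h1, h2]
  have hcol : ∑ col : Fin m → ZMod 2, (∏ j, bitWeight p (col j)) * g (col x) (col y)
      = 1 - p + p * ((1 + p) * (2 : ℝ) ^ (γ - 1)) := by
    have hsplit : ∀ a b, g a b = (if a = 1 then 0 else 1) * 1 + (if a = 1 then 1 else 0) * v b := by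
      intro a b
      by_cases h : a = 1 <;> simp [g, h]
    simp only [hsplit, mul_add, Finset.sum_add_distrib]
    rw [sum_bitWeight_two_coords p hxy (fun a => if a = 1 then 0 else 1) (fun _ => 1),
      sum_bitWeight_two_coords p hxy (fun a => if a = 1 then 1 else 0) v]
    have h2 : (2 : ℝ) ^ γ = 2 * 2 ^ (γ - 1) := by
      rw [Real.rpow_sub_one two_ne_zero]; ring
    simp [sum_zmod_two, bitWeight_zero, bitWeight_one, v, h2]
    exact Or.inl (by ring)
  rw [← hcol, ← Fin.prod_const, prod_sum_pi, ← (Matrix.transposeAddEquiv _ _ _).toEquiv.sum_comp]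
  refine Finset.sum_congr rfl fun X _ => ?_
  rw [hg, matWeight_eq, Finset.prod_comm, ← Finset.prod_mul_distrib]
  rfl

lemma sum_pow_hammingNorm (n : ℕ) (t : ℝ) :
    ∑ c : Fin n → ZMod 2, t ^ hammingNorm c = (1 + t) ^ n := by
  have h : 1 + t = ∑ b : ZMod 2, if b ≠ 0 then t else 1 := by simp [sum_zmod_two]
  rw [h, ← Fin.prod_const, prod_sum_pi]
  refine Finset.sum_congr rfl fun c _ => ?_
  rw [hammingNorm, ← Finset.prod_const, Finset.prod_filter]

/-- Rank–nullity: an `m × n` parity-check matrix has at least `2^(n-m)` codewords. -/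
lemma two_rpow_le_card_ker {m n : ℕ} (X : Matrix (Fin m) (Fin n) (ZMod 2)) :
    (2 : ℝ) ^ ((n : ℝ) - (m : ℝ)) ≤ (Nat.card {c : Fin n → ZMod 2 // X.mulVec c = 0} : ℝ) := by
  have e : Nat.card {c : Fin n → ZMod 2 // X.mulVec c = 0}
      = Nat.card (LinearMap.ker X.mulVecLin) := rfl
  have hrn := X.mulVecLin.finrank_range_add_finrank_ker
  have hr := (LinearMap.range X.mulVecLin).finrank_le
  rw [Module.finrank_fin_fun] at hrn hr
  rw [e, Module.natCard_eq_pow_finrank (K := ZMod 2), Nat.card_zmod, Nat.cast_pow, Nat.cast_two,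
    ← Real.rpow_natCast]
  refine Real.rpow_le_rpow_of_exponent_le one_le_two ?_
  have : (n : ℝ) ≤ m + Module.finrank (ZMod 2) (LinearMap.ker X.mulVecLin) := by
    exact_mod_cast (by omega : n ≤ m + Module.finrank (ZMod 2) (LinearMap.ker X.mulVecLin))
  linarith

/-- Union bound over low-weight words: weights below `W` and weights from `W` to `K` are
counted by the exponential moments at `s` and `t`. -/
lemma sum_low_weight_le {m n W : ℕ} {p s t K : ℝ} (hp0 : 0 < p) (hp1 : p < 1 / 2)
    (hs0 : 0 < s) (hs1 : s ≤ 1) (ht0 : 0 < t) (ht1 : t ≤ 1) :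
    ∑ c : Fin n → ZMod 2 with c ≠ 0 ∧ (hammingNorm c : ℝ) < K,
        ((1 + (1 - 2 * p) ^ hammingNorm c) / 2) ^ m
      ≤ (s ^ W)⁻¹ * (1 + s) ^ n * (1 - p) ^ m
        + t ^ (-K) * (1 + t) ^ n * ((1 + (1 - 2 * p) ^ W) / 2) ^ m := by
  have hq0 : 0 ≤ 1 - 2 * p := by linarith
  have hq1 : 1 - 2 * p ≤ 1 := by linarith
  have hA : 0 ≤ (1 - p) ^ m := pow_nonneg (by linarith) _
  have hB : 0 ≤ ((1 + (1 - 2 * p) ^ W) / 2) ^ m := by positivity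
  calc _ ≤ ∑ c : Fin n → ZMod 2 with c ≠ 0 ∧ (hammingNorm c : ℝ) < K,
        ((s ^ W)⁻¹ * s ^ hammingNorm c * (1 - p) ^ m
          + t ^ (-K) * t ^ hammingNorm c * ((1 + (1 - 2 * p) ^ W) / 2) ^ m) := by
        refine Finset.sum_le_sum fun c hc => ?_
        obtain ⟨hc0, hcK⟩ := (Finset.mem_filter.1 hc).2
        rcases lt_or_ge (hammingNorm c) W with h | h
        · refine le_add_of_le_of_nonneg ?_ (by positivity)
          have h1 : 1 ≤ (s ^ W)⁻¹ * s ^ hammingNorm c := by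
            rw [inv_mul_eq_div, one_le_div (by positivity)]
            exact pow_le_pow_of_le_one hs0.le hs1 h.le
          refine le_trans (pow_le_pow_left₀ (by positivity) ?_ _) (le_mul_of_one_le_left hA h1)
          have h2 : (1 - 2 * p) ^ hammingNorm c ≤ (1 - 2 * p) ^ 1 :=
            pow_le_pow_of_le_one hq0 hq1 (hammingNorm_pos_iff.2 hc0)
          linarith
        · refine le_add_of_nonneg_of_le (by positivity) ?_
          have h1 : 1 ≤ t ^ (-K) * t ^ hammingNorm c := by
            rw [← Real.rpow_natCast, ← Real.rpow_add ht0]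
            exact Real.one_le_rpow_of_pos_of_le_one_of_nonpos ht0 ht1 (by linarith)
          refine le_trans (pow_le_pow_left₀ (by positivity) ?_ _) (le_mul_of_one_le_left hB h1)
          have h2 : (1 - 2 * p) ^ hammingNorm c ≤ (1 - 2 * p) ^ W :=
            pow_le_pow_of_le_one hq0 hq1 h
          linarith
    _ ≤ ∑ c : Fin n → ZMod 2,
        ((s ^ W)⁻¹ * s ^ hammingNorm c * (1 - p) ^ m
          + t ^ (-K) * t ^ hammingNorm c * ((1 + (1 - 2 * p) ^ W) / 2) ^ m) :=
        Finset.sum_le_sum_of_subset_of_nonneg (Finset.filter_subset _ _)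
          fun c _ _ => by positivity
    _ = _ := by
        rw [Finset.sum_add_distrib, ← Finset.sum_mul, ← Finset.sum_mul, ← Finset.mul_sum,
          ← Finset.mul_sum, sum_pow_hammingNorm, sum_pow_hammingNorm]

/-- First-moment bound for an event all of whose matrices violate the distance or the
diversity requirement. -/
lemma matProb_le_of_forall_bad {m n : ℕ} {p γ K : ℝ} (hp0 : 0 ≤ p) (hp1 : p ≤ 1)
    (E : Set (Matrix (Fin m) (Fin n) (ZMod 2)))
    (hE : ∀ X ∈ E, (∃ c : Fin n → ZMod 2, c ≠ 0 ∧ (hammingNorm c : ℝ) < K ∧ X.mulVec c = 0) ∨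
      ∃ x y : Fin m, x ≠ y ∧
        ((rightNbrs X x \ rightNbrs X y).card : ℝ) ≤ γ * ((rightNbrs X x).card : ℝ)) :
    matProb m n p E ≤ ∑ c : Fin n → ZMod 2 with c ≠ 0 ∧ (hammingNorm c : ℝ) < K,
        ((1 + (1 - 2 * p) ^ hammingNorm c) / 2) ^ m
      + (m : ℝ) ^ 2 * (1 - p + p * ((1 + p) * (2 : ℝ) ^ (γ - 1))) ^ n := by
  let S : Finset (Fin n → ZMod 2) := {c | c ≠ 0 ∧ (hammingNorm c : ℝ) < K}
  let P : Finset (Fin m × Fin m) := {xy | xy.1 ≠ xy.2}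
  let a : Matrix (Fin m) (Fin n) (ZMod 2) → (Fin n → ZMod 2) → ℝ :=
    fun X c => if X.mulVec c = 0 then 1 else 0
  let b : Matrix (Fin m) (Fin n) (ZMod 2) → Fin m × Fin m → ℝ := fun X xy =>
    (2 : ℝ) ^ (γ * ((rightNbrs X xy.1).card : ℝ)
      - ((rightNbrs X xy.1 \ rightNbrs X xy.2).card : ℝ))
  have ha : ∀ X c, 0 ≤ a X c := fun X c => by simp only [a]; split_ifs <;> norm_num
  have hb : ∀ X xy, 0 ≤ b X xy := fun X xy => by positivity
  have hpt : ∀ X, E.indicator (matWeight m n p) X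
      ≤ matWeight m n p X * (∑ c ∈ S, a X c + ∑ xy ∈ P, b X xy) := by
    intro X
    have hw := matWeight_nonneg hp0 hp1 X
    have hsa : 0 ≤ ∑ c ∈ S, a X c := Finset.sum_nonneg fun c _ => ha X c
    have hsb : 0 ≤ ∑ xy ∈ P, b X xy := Finset.sum_nonneg fun c _ => hb X c
    by_cases hX : X ∈ E
    · rw [Set.indicator_of_mem hX]
      refine le_mul_of_one_le_right hw ?_
      rcases hE X hX with ⟨c, hc0, hcK, hXc⟩ | ⟨x, y, hxy, hle⟩
      · have h1 : a X c ≤ ∑ c ∈ S, a X c :=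
          Finset.single_le_sum (fun c _ => ha X c)
            (Finset.mem_filter.2 ⟨Finset.mem_univ _, hc0, hcK⟩)
        have h2 : a X c = 1 := if_pos hXc
        linarith
      · have h1 : b X (x, y) ≤ ∑ xy ∈ P, b X xy :=
          Finset.single_le_sum (fun c _ => hb X c)
            (Finset.mem_filter.2 ⟨Finset.mem_univ _, hxy⟩)
        have h2 : 1 ≤ b X (x, y) := Real.one_le_rpow one_le_two (by simpa using hle)
        linarith
    · rw [Set.indicator_of_notMem hX]
      positivity
  have hM : 0 ≤ (1 - p + p * ((1 + p) * (2 : ℝ) ^ (γ - 1))) ^ n := by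
    have : 0 ≤ 1 - p := by linarith
    positivity
  have hP : (P.card : ℝ) ≤ (m : ℝ) ^ 2 := by
    have : P.card ≤ m ^ 2 := by
      refine (Finset.card_le_univ P).trans (le_of_eq ?_)
      simp [sq]
    exact_mod_cast this
  calc matProb m n p E ≤ ∑ X, matWeight m n p X * (∑ c ∈ S, a X c + ∑ xy ∈ P, b X xy) :=
        Finset.sum_le_sum fun X _ => hpt X
    _ = ∑ c ∈ S, ∑ X, matWeight m n p X * a X c
        + ∑ xy ∈ P, ∑ X, matWeight m n p X * b X xy := by
        simp only [mul_add, Finset.mul_sum, Finset.sum_add_distrib]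
        congr 1 <;> exact Finset.sum_comm
    _ = ∑ c ∈ S, ((1 + (1 - 2 * p) ^ hammingNorm c) / 2) ^ m
        + ∑ xy ∈ P, (1 - p + p * ((1 + p) * (2 : ℝ) ^ (γ - 1))) ^ n := by
        congr 1
        · exact Finset.sum_congr rfl fun c _ => sum_matWeight_mulVec_eq_zero m n p c
        · exact Finset.sum_congr rfl fun xy hxy =>
            sum_matWeight_diversity p γ (Finset.mem_filter.1 hxy).2
    _ ≤ _ := by
        rw [Finset.sum_const, nsmul_eq_mul]
        gcongr

lemma binH_pos {δ : ℝ} (h0 : 0 < δ) (h1 : δ < 1) : 0 < binH δ := by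
  have ha : Real.logb 2 δ < 0 := Real.logb_neg one_lt_two h0 h1
  have hb : Real.logb 2 (1 - δ) < 0 := Real.logb_neg one_lt_two (by linarith) (by linarith)
  unfold binH
  nlinarith

/-- The exponential moment bound at the optimal parameter `δ / (1 - δ)` is `2 ^ H(δ)`. -/
lemma one_add_mul_rpow_eq_two_rpow_binH {δ : ℝ} (h0 : 0 < δ) (h1 : δ < 1) :
    (1 + δ / (1 - δ)) * (δ / (1 - δ)) ^ (-δ) = (2 : ℝ) ^ binH δ := by
  have h1' : 0 < 1 - δ := by linarith
  have e : 1 + δ / (1 - δ) = (1 - δ)⁻¹ := by field_simp; ring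
  have hl : Real.log 2 ≠ 0 := (Real.log_pos one_lt_two).ne'
  rw [e]
  apply Real.log_injOn_pos (Set.mem_Ioi.2 (by positivity)) (Set.mem_Ioi.2 (by positivity))
  rw [Real.log_mul (by positivity) (by positivity), Real.log_inv, Real.log_rpow (by positivity),
    Real.log_div h0.ne' h1'.ne', Real.log_rpow two_pos, binH, Real.logb, Real.logb]
  field_simp
  ring

lemma exists_exp_gt {A B ε a b c : ℝ}
    (ha0 : 0 ≤ a) (ha : a < 1) (hb0 : 0 ≤ b) (hb : b < 1) (hc0 : 0 ≤ c) (hc : c < 1) :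
    ∃ D : ℝ, 0 < D ∧ ∃ n₀ : ℕ, ∀ n : ℕ, n₀ ≤ n →
      A * a ^ n + B * b ^ n + (ε * n + 1) ^ 2 * c ^ n < Real.exp (-D * n) := by
  obtain ⟨r, hr, hr1⟩ := exists_between (max_lt ha (max_lt hb hc))
  have har : a < r := (le_max_left _ _).trans_lt hr
  have hbr : b < r := ((le_max_left _ _).trans (le_max_right _ _)).trans_lt hr
  have hcr : c < r := ((le_max_right _ _).trans (le_max_right _ _)).trans_lt hr
  have hr0 : 0 < r := ha0.trans_lt har
  have lim : ∀ (k : ℕ) (z : ℝ), 0 ≤ z → z < r →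
      Filter.Tendsto (fun n : ℕ => (n : ℝ) ^ k * (z / r) ^ n) Filter.atTop (nhds 0) := by
    intro k z hz hzr
    refine tendsto_pow_const_mul_const_pow_of_abs_lt_one k ?_
    rw [abs_of_nonneg (by positivity)]
    exact (div_lt_one hr0).2 hzr
  have key := (((lim 0 a ha0 har).const_mul A).add ((lim 0 b hb0 hbr).const_mul B)).add
    ((((lim 2 c hc0 hcr).const_mul (ε ^ 2)).add ((lim 1 c hc0 hcr).const_mul (2 * ε))).add
      (lim 0 c hc0 hcr))
  simp only [mul_zero, add_zero] at key
  obtain ⟨n₀, hn₀⟩ := Filter.eventually_atTop.1 (key.eventually_lt_const one_pos)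
  refine ⟨-Real.log r, neg_pos.2 (Real.log_neg hr0 hr1), n₀, fun n hn => ?_⟩
  have hexp : Real.exp (- -Real.log r * n) = r ^ n := by
    rw [neg_neg, mul_comm, Real.exp_nat_mul, Real.exp_log hr0]
  have h := mul_lt_mul_of_pos_right (hn₀ n hn) (pow_pos hr0 n)
  rw [hexp]
  have hrn : r ^ n ≠ 0 := (pow_pos hr0 n).ne'
  simp only [div_pow] at h
  field_simp at h
  refine lt_of_eq_of_lt ?_ h
  ring

lemma pow_ceil_le {a ε : ℝ} (ha0 : 0 < a) (ha1 : a ≤ 1) (n : ℕ) :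
    a ^ ⌈ε * n⌉₊ ≤ (a ^ ε) ^ n := by
  rw [← Real.rpow_natCast, ← Real.rpow_natCast, ← Real.rpow_mul ha0.le]
  exact Real.rpow_le_rpow_of_exponent_ge ha0 ha1 (Nat.le_ceil _)

/-- Theorem 1: given `0 < δ < 1/2`, `0 < γ < 1` and `ε > H(δ)`, there are constants
`p ∈ (0,1/2)`, `D > 0` and `n₀` such that for every `n ≥ n₀`, with `m = ⌈εn⌉`, every
event `E` of `m × n` binary matrices of probability at least `e^{-Dn}` contains a
parity-check matrix `H` whose kernel code has minimum Hamming distance at least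
`δn + 1`, diversity index at least `γ`, and size at least `2^{n-m}` (i.e. redundancy
at most `ε` up to `o(1)`). -/
theorem linear_code_with_constraints (δ γ ε : ℝ)
    (hδ0 : 0 < δ) (hδ1 : δ < 1 / 2) (hγ0 : 0 < γ) (hγ1 : γ < 1) (hε : binH δ < ε) :
    ∃ p : ℝ, 0 < p ∧ p < 1 / 2 ∧ ∃ D : ℝ, 0 < D ∧ ∃ n₀ : ℕ, ∀ n : ℕ, n₀ ≤ n →
      ∀ E : Set (Matrix (Fin ⌈ε * n⌉₊) (Fin n) (ZMod 2)),
        Real.exp (-D * n) ≤ matProb ⌈ε * n⌉₊ n p E →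
        ∃ H ∈ E,
          -- (i) minimum Hamming distance at least δn + 1
          (∀ c d : Fin n → ZMod 2, H.mulVec c = 0 → H.mulVec d = 0 → c ≠ d →
            δ * n + 1 ≤ (hammingDist c d : ℝ)) ∧
          -- (ii) diversity index at least γ
          (∀ x y : Fin ⌈ε * n⌉₊, x ≠ y →
            γ * ((rightNbrs H x).card : ℝ) ≤ ((rightNbrs H x \ rightNbrs H y).card : ℝ)) ∧
          -- (iii) #C ≥ 2^{n - m}, i.e. redundancy at most ε
          (2 : ℝ) ^ ((n : ℝ) - (⌈ε * n⌉₊ : ℝ)) ≤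
            (Nat.card {c : Fin n → ZMod 2 // H.mulVec c = 0} : ℝ) := by
  have hε0 : 0 < ε := (binH_pos hδ0 (by linarith)).trans hε
  have h2γ : (1 : ℝ) < 2 ^ (1 - γ) := Real.one_lt_rpow one_lt_two (by linarith)
  obtain ⟨p, hp0, hp⟩ := exists_between
    (lt_min (show (0 : ℝ) < 1 / 2 by norm_num) (sub_pos.2 h2γ))
  have hp1 : p < 1 / 2 := hp.trans_le (min_le_left _ _)
  have hpγ : (1 + p) * (2 : ℝ) ^ (γ - 1) < 1 := by
    have h1 : 1 + p < 2 ^ (1 - γ) := by linarith [hp.trans_le (min_le_right _ _)]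
    rw [← neg_sub 1 γ, Real.rpow_neg two_pos.le, ← div_eq_mul_inv]
    exact (div_lt_one (by positivity)).2 h1
  -- exponential rate for words of bounded weight
  have hpε : (1 - p) ^ ε < 1 := Real.rpow_lt_one (by linarith) (by linarith) hε0
  have hpε0 : 0 < (1 - p) ^ ε := Real.rpow_pos_of_pos (by linarith) _
  obtain ⟨s, hs0, hs⟩ := exists_between
    (lt_min one_pos (sub_pos.2 ((one_lt_inv₀ hpε0).2 hpε)))
  have hs1 : s ≤ 1 := (hs.trans_le (min_le_left _ _)).le
  have hsρ : (1 + s) * (1 - p) ^ ε < 1 := by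
    have h1 : 1 + s < ((1 - p) ^ ε)⁻¹ := by linarith [hs.trans_le (min_le_right _ _)]
    rwa [← lt_div_iff₀ hpε0, one_div]
  -- exponential rate for words of large weight
  set t := δ / (1 - δ) with ht
  have ht0 : 0 < t := div_pos hδ0 (by linarith)
  have ht1 : t ≤ 1 := (div_le_one (by linarith)).2 (by linarith)
  obtain ⟨W, hW⟩ : ∃ W : ℕ, (2 : ℝ) ^ binH δ * ((1 + (1 - 2 * p) ^ W) / 2) ^ ε < 1 := by
    have l1 : Filter.Tendsto (fun W : ℕ => (1 + (1 - 2 * p) ^ W) / 2) Filter.atTop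
        (nhds ((1 + 0) / 2)) :=
      ((tendsto_pow_atTop_nhds_zero_of_lt_one (by linarith) (by linarith)).const_add 1).div_const 2
    have l2 := (l1.rpow_const (p := ε) (Or.inl (by norm_num))).const_mul ((2 : ℝ) ^ binH δ)
    refine (l2.eventually_lt_const ?_).exists
    have h1 : ((1 + 0) / 2 : ℝ) ^ ε = 2 ^ (-ε) := by
      rw [add_zero, one_div, Real.inv_rpow two_pos.le, Real.rpow_neg two_pos.le]
    rw [h1, ← Real.rpow_add two_pos]
    exact Real.rpow_lt_one_of_one_lt_of_neg one_lt_two (by linarith)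
  have hq0 : 0 < 1 - 2 * p := by linarith
  set a := (1 + (1 - 2 * p) ^ W) / 2 with ha
  have ha0 : 0 < a := by positivity
  have ha1 : a ≤ 1 := by
    have : (1 - 2 * p) ^ W ≤ 1 := pow_le_one₀ hq0.le (by linarith)
    rw [ha]; linarith
  have h1p : 0 < 1 - p := by linarith
  obtain ⟨D, hD, n₀, hn₀⟩ := exists_exp_gt (A := (s ^ W)⁻¹) (B := t ^ (-1 : ℝ)) (ε := ε)
    (by positivity) hsρ (by positivity) hW
    (c := 1 - p + p * ((1 + p) * (2 : ℝ) ^ (γ - 1))) (by positivity) (by nlinarith)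
  refine ⟨p, hp0, hp1, D, hD, n₀, fun n hn E hE => ?_⟩
  by_contra! hbad
  have hprob := matProb_le_of_forall_bad (γ := γ) (K := δ * n + 1) hp0.le (by linarith) E (by
    intro X hX
    by_contra! hX'
    obtain ⟨hdist, hdiv⟩ := hX'
    refine (hbad X hX (fun c d hc hd hcd => ?_) fun x y hxy => (hdiv x y hxy).le).not_ge
      (two_rpow_le_card_ker X)
    by_contra! hlt
    rw [hammingDist_eq_hammingNorm, neg_add_eq_sub] at hlt
    refine hdist (d - c) (sub_ne_zero.2 hcd.symm) hlt ?_
    rw [Matrix.mulVec_sub, hc, hd, sub_zero])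
  have hlow := sum_low_weight_le (m := ⌈ε * n⌉₊) (n := n) (W := W) (K := δ * n + 1)
    hp0 hp1 hs0 hs1 ht0 ht1
  have h1 : (s ^ W)⁻¹ * (1 + s) ^ n * (1 - p) ^ ⌈ε * n⌉₊
      ≤ (s ^ W)⁻¹ * ((1 + s) * (1 - p) ^ ε) ^ n := by
    rw [mul_pow, mul_assoc]
    gcongr
    exact pow_ceil_le h1p (by linarith) n
  have h2 : t ^ (-(δ * n + 1)) * (1 + t) ^ n * a ^ ⌈ε * n⌉₊
      ≤ t ^ (-1 : ℝ) * (2 ^ binH δ * a ^ ε) ^ n := by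
    have e : t ^ (-(δ * n + 1)) = t ^ (-1 : ℝ) * (t ^ (-δ)) ^ n := by
      rw [← Real.rpow_natCast (t ^ (-δ)), ← Real.rpow_mul ht0.le, ← Real.rpow_add ht0]
      congr 1; ring
    rw [← one_add_mul_rpow_eq_two_rpow_binH hδ0 (by linarith), ← ht, e, mul_pow, mul_pow]
    calc _ = t ^ (-1 : ℝ) * ((1 + t) ^ n * (t ^ (-δ)) ^ n * a ^ ⌈ε * n⌉₊) := by ring
      _ ≤ _ := by
        gcongr
        exact pow_ceil_le ha0 ha1 n
  have h3 : (⌈ε * n⌉₊ : ℝ) ^ 2 * (1 - p + p * ((1 + p) * (2 : ℝ) ^ (γ - 1))) ^ n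
      ≤ (ε * n + 1) ^ 2 * (1 - p + p * ((1 + p) * (2 : ℝ) ^ (γ - 1))) ^ n := by
    gcongr
    exact (Nat.ceil_lt_add_one (by positivity)).le
  linarith [hn₀ n hn]
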